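/- arXiv:2602.21815 — 4 statements merged into one kernel-verified Lean document; each statement's English description precedes it below -/
import Mathlib

section
/- Let f: ℕ → ℝ be a gently growing function. Then there exist real constants B, C > 0 such that for every integer m ≥ C there exists a prime p > m with f(p) ≥ 2m and 2m ≥ B·f(p^m). -/
/-- A function `f : ℕ → ℝ` is *gently growing* if it is unbounded, non-decreasing,
positive, and there exist constants `A, N > 0` such that
`f(⌊x ^ log x⌋) ≤ A * f x` for all integers `x ≥ N`. -/
def GentlyGrowing (f : ℕ → ℝ) : Prop :=
  (∀ B : ℝ, ∃ n : ℕ, B < f n) ∧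
  (∀ m n : ℕ, m ≤ n → f m ≤ f n) ∧
  (∀ n : ℕ, 0 < f n) ∧
  ∃ A : ℝ, 0 < A ∧ ∃ N : ℕ, 0 < N ∧
    ∀ x : ℕ, N ≤ x → f ⌊(x : ℝ) ^ Real.log x⌋₊ ≤ A * f x

open Filter in
/-- A gently growing function grows at most logarithmically. -/
theorem GentlyGrowing.exists_le_mul_log {f : ℕ → ℝ} (hf : GentlyGrowing f) :
    ∃ K : ℝ, 0 < K ∧ ∀ x : ℕ, 2 ≤ x → f x ≤ K * Real.log x := by
  obtain ⟨-, hmono, hpos, A, hA, N, hN, hAN⟩ := hf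
  have hlim : Tendsto (fun x : ℕ => √(Real.log x)) atTop atTop :=
    Real.tendsto_sqrt_atTop.comp (Real.tendsto_log_atTop.comp tendsto_natCast_atTop_atTop)
  obtain ⟨X, hX⟩ := eventually_atTop.1 (hlim.eventually_ge_atTop (A + 1 + N))
  have hlog2 : 0 < Real.log 2 := Real.log_pos (by norm_num)
  have hK : 0 < f X / Real.log 2 := div_pos (hpos X) hlog2
  refine ⟨f X / Real.log 2, hK, fun x => ?_⟩
  induction x using Nat.strong_induction_on with
  | _ x ih =>
  intro hx
  have hx2 : (2 : ℝ) ≤ x := by exact_mod_cast hx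
  rcases le_total x X with hxX | hxX
  · calc f x ≤ f X := hmono _ _ hxX
      _ = f X / Real.log 2 * Real.log 2 := by field_simp
      _ ≤ f X / Real.log 2 * Real.log x := by gcongr
  · have hr := hX x hxX
    have hsq : √(Real.log x) ^ 2 = Real.log x :=
      Real.sq_sqrt (Real.log_nonneg (by linarith))
    set r := √(Real.log x)
    have hN1 : (1 : ℝ) ≤ N := by exact_mod_cast hN
    have hr2 : A + 2 ≤ r := by linarith
    have hAr : A * (r + 1) ≤ r ^ 2 := by nlinarith
    have hr1 : r + 1 < r ^ 2 := by nlinarith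
    set s := ⌈Real.exp r⌉₊
    have hs : Real.exp r ≤ s := Nat.le_ceil _
    have hexp : r + 1 ≤ Real.exp r := Real.add_one_le_exp r
    have hs' : (s : ℝ) ≤ Real.exp (r + 1) := by
      have h1 : (s : ℝ) < Real.exp r + 1 := Nat.ceil_lt_add_one (Real.exp_pos r).le
      have h2 : (2 : ℝ) ≤ Real.exp 1 := by linarith [Real.add_one_le_exp (1 : ℝ)]
      rw [Real.exp_add]
      nlinarith
    have hspos : (0 : ℝ) < s := (Real.exp_pos r).trans_le hs
    have hlog_le : Real.log s ≤ r + 1 := (Real.log_le_iff_le_exp hspos).2 hs'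
    have hle_log : r ≤ Real.log s := (Real.le_log_iff_exp_le hspos).2 hs
    have hNs : N ≤ s := by
      have : (N : ℝ) ≤ s := by linarith
      exact_mod_cast this
    have hs2 : 2 ≤ s := by
      have : (2 : ℝ) ≤ s := by linarith
      exact_mod_cast this
    have hxpos : (0 : ℝ) < x := by linarith
    have hsx : s < x := by
      have : (s : ℝ) < x := by
        rw [← Real.log_lt_log_iff hspos hxpos]
        linarith
      exact_mod_cast this
    have hxs : x ≤ ⌊(s : ℝ) ^ Real.log s⌋₊ := by
      apply Nat.le_floor
      rw [Real.rpow_def_of_pos hspos, ← Real.log_le_iff_le_exp hxpos]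
      nlinarith
    calc f x ≤ f ⌊(s : ℝ) ^ Real.log s⌋₊ := hmono _ _ hxs
      _ ≤ A * f s := hAN s hNs
      _ ≤ A * (f X / Real.log 2 * Real.log s) := by
        gcongr
        exact ih s hsx hs2
      _ = f X / Real.log 2 * (A * Real.log s) := by ring
      _ ≤ f X / Real.log 2 * Real.log x := by
        gcongr
        nlinarith

/-- If `c ≤ log x` then `x ^ c ≤ ⌊x ^ log x⌋`. -/
theorem pow_le_floor_rpow_log {x c : ℕ} (hx : 1 ≤ x) (hc : (c : ℝ) ≤ Real.log x) :
    x ^ c ≤ ⌊(x : ℝ) ^ Real.log x⌋₊ := by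
  apply Nat.le_floor
  push_cast
  rw [← Real.rpow_natCast]
  exact Real.rpow_le_rpow_of_exponent_le (by exact_mod_cast hx) hc

open Filter in
/-- For a gently growing `f` there are constants `B, C > 0` such that for every
integer `m ≥ C` there is a prime `p > m` with `f p ≥ 2m ≥ B * f (p ^ m)`. -/
theorem exists_prime_of_gentlyGrowing (f : ℕ → ℝ) (hf : GentlyGrowing f) :
    ∃ B C : ℝ, 0 < B ∧ 0 < C ∧ ∀ m : ℕ, C ≤ (m : ℝ) →
      ∃ p : ℕ, p.Prime ∧ m < p ∧ 2 * (m : ℝ) ≤ f p ∧ B * f (p ^ m) ≤ 2 * (m : ℝ) := by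
  obtain ⟨K, hK, hlog⟩ := hf.exists_le_mul_log
  obtain ⟨hunb, hmono, hpos, A, hA, N, hN, hAN⟩ := hf
  obtain ⟨c, hc⟩ := exists_nat_ge (K + 2)
  have hlogTop : Tendsto (fun x : ℕ => Real.log x) atTop atTop :=
    Real.tendsto_log_atTop.comp tendsto_natCast_atTop_atTop
  have hlittle : ∀ᶠ x : ℕ in atTop, K * Real.log x ≤ x := by
    filter_upwards [tendsto_natCast_atTop_atTop.eventually
      (Real.isLittleO_log_id_atTop.bound (inv_pos.2 hK))] with x hx
    have h := (le_abs_self _).trans hx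
    rw [id, Real.norm_natCast] at h
    calc K * Real.log x ≤ K * (K⁻¹ * x) := by gcongr
      _ = x := by field_simp
  obtain ⟨X, hX⟩ := eventually_atTop.1
    ((hlogTop.eventually_ge_atTop (c : ℝ)).and (hlittle.and (eventually_ge_atTop (N + 2))))
  refine ⟨(A ^ 3)⁻¹, f (X + 1), by positivity, hpos _, fun m hm => ?_⟩
  have hm0 : (0 : ℝ) < m := (hpos _).trans_le hm
  have hex : ∃ n, 2 * (m : ℝ) ≤ f n := (hunb (2 * m)).imp fun n hn => hn.le
  classical
  obtain ⟨x, hx, hmin⟩ : ∃ x, 2 * (m : ℝ) ≤ f x ∧ ∀ y < x, f y < 2 * m :=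
    ⟨Nat.find hex, Nat.find_spec hex, fun y hy => not_le.1 (Nat.find_min hex hy)⟩
  have hXx : X + 1 < x := by
    by_contra! h
    linarith [hmono _ _ h]
  obtain ⟨y, rfl⟩ : ∃ y, x = y + 1 := ⟨x - 1, by omega⟩
  obtain ⟨hcy, -, hNy⟩ := hX y (by omega)
  obtain ⟨hcx, hKx, hNx⟩ := hX (y + 1) (by omega)
  have hfy : f y < 2 * m := hmin y (by omega)
  have hc2 : 2 ≤ c := by
    have : (2 : ℝ) ≤ c := by linarith
    exact_mod_cast this
  have hxy : y + 1 ≤ ⌊(y : ℝ) ^ Real.log y⌋₊ :=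
    calc y + 1 ≤ y ^ 2 := by nlinarith
      _ ≤ y ^ c := Nat.pow_le_pow_right (by omega) hc2
      _ ≤ _ := pow_le_floor_rpow_log (by omega) hcy
  have hfx : f (y + 1) ≤ A * (2 * m) :=
    calc f (y + 1) ≤ f ⌊(y : ℝ) ^ Real.log y⌋₊ := hmono _ _ hxy
      _ ≤ A * f y := hAN y (by omega)
      _ ≤ A * (2 * m) := by gcongr
  have h2m : 2 * (m : ℝ) ≤ K * Real.log (y + 1 : ℕ) := hx.trans (hlog _ (by omega))
  clear hcy hNy hfy hxy hmin
  generalize y + 1 = x at *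
  have hx1 : (1 : ℝ) ≤ x := by
    have : 1 ≤ x := by omega
    exact_mod_cast this
  obtain ⟨p, hp, hxp, hpx⟩ := Nat.exists_prime_lt_and_le_two_mul x (by omega)
  refine ⟨p, hp, ?_, hx.trans (hmono _ _ hxp.le), ?_⟩
  · have : (m : ℝ) < x := by linarith
    exact (Nat.cast_lt.1 this).trans hxp
  have hw := pow_le_floor_rpow_log (by omega) hcx
  have hfw := hAN x (by omega)
  set w := ⌊(x : ℝ) ^ Real.log x⌋₊
  have hxw : x ≤ w := (Nat.le_self_pow (by omega) x).trans hw
  have hwR : ((x : ℝ) ^ c) ≤ w := by exact_mod_cast hw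
  have hxwR : (x : ℝ) ≤ w := by exact_mod_cast hxw
  have hpw : p ^ m ≤ ⌊(w : ℝ) ^ Real.log w⌋₊ := by
    have hpx2 : p ≤ x ^ 2 := by nlinarith
    apply Nat.le_floor
    calc ((p ^ m : ℕ) : ℝ) ≤ ((x ^ 2) ^ m : ℕ) := by
          exact_mod_cast Nat.pow_le_pow_left hpx2 m
      _ = (x : ℝ) ^ (2 * (m : ℝ)) := by
          rw [← pow_mul]
          exact_mod_cast (Real.rpow_natCast (x : ℝ) (2 * m)).symm
      _ ≤ (x : ℝ) ^ (c * Real.log x) := by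
          apply Real.rpow_le_rpow_of_exponent_le hx1
          have := Real.log_nonneg hx1
          nlinarith
      _ = ((x : ℝ) ^ c) ^ Real.log x := by
          rw [Real.rpow_mul (by positivity), Real.rpow_natCast]
      _ ≤ (w : ℝ) ^ Real.log x :=
          Real.rpow_le_rpow (by positivity) hwR (Real.log_nonneg hx1)
      _ ≤ (w : ℝ) ^ Real.log w :=
          Real.rpow_le_rpow_of_exponent_le (hx1.trans hxwR)
            (Real.log_le_log (by linarith) hxwR)
  rw [inv_mul_le_iff₀ (by positivity)]
  calc f (p ^ m) ≤ f ⌊(w : ℝ) ^ Real.log w⌋₊ := hmono _ _ hpw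
    _ ≤ A * f w := hAN w (by omega)
    _ ≤ A * (A * (A * (2 * m))) := by
      gcongr
      exact hfw.trans (by gcongr)
    _ = A ^ 3 * (2 * m) := by ring
end

section
/- For every prime p ≥ 13, the minimal index of a proper subgroup of PSL₂(F_p) equals p+1; that is, every proper subgroup of PSL₂(F_p) has index at least p+1, and there exists a subgroup of index exactly p+1 (the stabilizer of a point of the projective line over F_p). -/
open Matrix Matrix.SpecialLinearGroup
open scoped MatrixGroups LinearAlgebra.Projectivization

namespace SL2Degree

section Relations

variable {F : Type*} [Field F]

/-- The upper unipotent matrix with off-diagonal entry `s`. -/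
def unip (s : F) : SL(2, F) := ⟨!![1, s; 0, 1], by simp⟩

/-- The diagonal matrix with entries `t` and `t⁻¹`. -/
def torus (t : Fˣ) : SL(2, F) := ⟨!![(t : F), 0; 0, (t : F)⁻¹], by simp⟩

/-- The Weyl element. -/
def weyl : SL(2, F) := ⟨!![0, 1; -1, 0], by simp⟩

@[simp] lemma coe_unip (s : F) : (unip s : Matrix (Fin 2) (Fin 2) F) = !![1, s; 0, 1] := rfl

@[simp] lemma coe_torus (t : Fˣ) :
    (torus t : Matrix (Fin 2) (Fin 2) F) = !![(t : F), 0; 0, (t : F)⁻¹] := rfl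

@[simp] lemma coe_weyl : ((weyl : SL(2, F)) : Matrix (Fin 2) (Fin 2) F) = !![0, 1; -1, 0] := rfl

lemma unip_zero : unip (0 : F) = 1 :=
  Subtype.ext <| by simp [Matrix.one_fin_two]

lemma unip_add (r s : F) : unip (r + s) = unip r * unip s :=
  Subtype.ext <| by simp [add_comm]

lemma torus_mul_unip (t : Fˣ) (s : F) :
    torus t * unip s = unip ((t : F) ^ 2 * s) * torus t :=
  Subtype.ext <| by simp; field_simp

lemma torus_mul_comm (t r : Fˣ) : torus t * torus r = torus r * torus t :=
  Subtype.ext <| by simp [mul_comm]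

lemma torus_inv_mul_torus (t : Fˣ) : torus t⁻¹ * torus t = 1 :=
  Subtype.ext <| by simp [Matrix.one_fin_two]

lemma torus_mul_weyl (t : Fˣ) : torus t * weyl = weyl * torus t⁻¹ :=
  Subtype.ext <| by simp

lemma weyl_mul_weyl : (weyl : SL(2, F)) * weyl = torus (-1) :=
  Subtype.ext <| by simp

lemma unip_weyl_unip (s : Fˣ) :
    unip (s : F) * (torus s * weyl) * unip (s : F) =
      torus s * weyl * unip (-(s : F)) * (torus s * weyl) :=
  Subtype.ext <| by simp

lemma transvection_zero_one (s : F) :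
    (transvection (zero_ne_one : (0 : Fin 2) ≠ 1) s : SL(2, F)) = unip s := by
  ext i j; fin_cases i <;> fin_cases j <;> simp [transvection_coe]

lemma transvection_one_zero (s : F) :
    weyl * (transvection (one_ne_zero : (1 : Fin 2) ≠ 0) s : SL(2, F)) = unip (-s) * weyl := by
  ext i j; fin_cases i <;> fin_cases j <;>
    simp [transvection_coe, Matrix.mul_apply, Fin.sum_univ_two]

/-- An action of `SL(2, F)` in which the upper unipotent matrices act trivially is trivial. -/
lemma smul_eq_of_unip_smul_eq {X : Type*} [MulAction SL(2, F) X]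
    (h : ∀ (s : F) (x : X), unip s • x = x) (g : SL(2, F)) (x : X) : g • x = x := by
  revert x
  refine SL2.transvection_induction (fun g => ∀ x : X, g • x = x) (fun i j hij c x => ?_)
    (fun A B hA hB x => by rw [mul_smul, hB, hA]) g
  fin_cases i <;> fin_cases j
  · exact absurd rfl hij
  · exact (congrArg (· • x) (transvection_zero_one c)).trans (h c x)
  · have hw := congrArg (· • x) (transvection_one_zero c)
    simp only [mul_smul, h] at hw
    exact smul_left_cancel _ hw
  · exact absurd rfl hij

end Relations

section Arithmetic

variable {p : ℕ} [Fact p.Prime]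

lemma natCast_ne_zero_of_lt {k : ℕ} (hk : 0 < k) (hkp : k < p) : (k : ZMod p) ≠ 0 := by
  rw [Ne, ZMod.natCast_eq_zero_iff]
  exact Nat.not_dvd_of_pos_of_lt hk hkp

lemma not_isSquare_five_zmod_23 : ¬IsSquare (5 : ZMod 23) := by decide

lemma isSquare_mul_of_not_isSquare {x y : ZMod p} (hx : ¬IsSquare x) (hy : ¬IsSquare y) :
    IsSquare (x * y) := by
  have hx0 : x ≠ 0 := fun h => hx (h ▸ IsSquare.zero)
  have hy0 : y ≠ 0 := fun h => hy (h ▸ IsSquare.zero)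
  rw [← quadraticChar_one_iff_isSquare (mul_ne_zero hx0 hy0), map_mul,
    quadraticChar_neg_one_iff_not_isSquare.2 hx, quadraticChar_neg_one_iff_not_isSquare.2 hy]
  norm_num

lemma not_isSquare_mul {x y : ZMod p} (hx : IsSquare x) (hx0 : x ≠ 0) (hy : ¬IsSquare y) :
    ¬IsSquare (x * y) := by
  intro h
  apply hy
  have := h.div hx
  rwa [mul_div_cancel_left₀ _ hx0] at this

/-- A function of the form `x ↦ a / x` cannot satisfy the braid relation. -/
lemma false_of_mul_eq_const (h13 : 13 ≤ p) {W : ZMod p → ZMod p} {a : ZMod p} (h0 : W 0 = 0)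
    (ha : ∀ x, x ≠ 0 → x * W x = a) (hR : ∀ x, W (W x - 1) = W (x + 1) + 1) : False := by
  have h2 : ((2 : ℕ) : ZMod p) ≠ 0 := natCast_ne_zero_of_lt (by omega) (by omega)
  have h3 : ((3 : ℕ) : ZMod p) ≠ 0 := natCast_ne_zero_of_lt (by omega) (by omega)
  have h5 : ((5 : ℕ) : ZMod p) ≠ 0 := natCast_ne_zero_of_lt (by omega) (by omega)
  push_cast at h2 h3 h5
  have e0 := hR 0
  have e1 := hR 1
  have a1 := ha 1 one_ne_zero
  have am := ha (-1) (neg_ne_zero.2 one_ne_zero)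
  rw [one_mul] at a1
  rw [h0, zero_sub, zero_add, a1] at e0
  rw [a1, show (1 : ZMod p) + 1 = 2 by norm_num] at e1
  have a2 := ha 2 h2
  have ha2 : 2 * a = -1 := by rw [e0] at am; linear_combination -am
  have hz : a - 1 ≠ 0 := fun h => h3 (by linear_combination ha2 - 2 * h)
  have az := ha _ hz
  rw [e1] at az
  exact h5 (by linear_combination (-4) * az * 2 + (a - 1) * 4 * a2 + (2 * a - 3) * ha2)

/-- The braid relation is impossible when `-1` is not a square and `x * W x` takes square values
`a` and `b` on squares and nonsquares. -/
lemma false_of_neg_one_not_isSquare (h13 : 13 ≤ p) {W : ZMod p → ZMod p} {a b : ZMod p}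
    (hm : ¬IsSquare (-1 : ZMod p)) (h0 : W 0 = 0) (hsa : IsSquare a) (hsb : IsSquare b)
    (ha : ∀ x, x ≠ 0 → IsSquare x → x * W x = a) (hb : ∀ x, ¬IsSquare x → x * W x = b)
    (hR : ∀ x, W (W x - 1) = W (x + 1) + 1) (hR' : ∀ x, W (W x + 1) = W (x - 1) - 1) :
    False := by
  have h2 : ((2 : ℕ) : ZMod p) ≠ 0 := natCast_ne_zero_of_lt (by omega) (by omega)
  have h3 : ((3 : ℕ) : ZMod p) ≠ 0 := natCast_ne_zero_of_lt (by omega) (by omega)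
  have h5 : ((5 : ℕ) : ZMod p) ≠ 0 := natCast_ne_zero_of_lt (by omega) (by omega)
  have h7 : ((7 : ℕ) : ZMod p) ≠ 0 := natCast_ne_zero_of_lt (by omega) (by omega)
  have h11 : ((11 : ℕ) : ZMod p) ≠ 0 := natCast_ne_zero_of_lt (by omega) (by omega)
  have h23 : (23 : ZMod p) = 0 → ¬IsSquare (5 : ZMod p) := by
    intro h
    have hd : p ∣ 23 := (ZMod.natCast_eq_zero_iff 23 p).1 (by exact_mod_cast h)
    obtain h1 | rfl := (Nat.dvd_prime (by norm_num)).1 hd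
    · omega
    · exact not_isSquare_five_zmod_23
  push_cast at h2 h3 h5 h7 h11
  have hab : ∀ x, x ≠ 0 → x * W x = a ∨ x * W x = b := fun x hx =>
    (em (IsSquare x)).imp (ha x hx) (hb x)
  have neg_ns : ∀ x : ZMod p, x ≠ 0 → IsSquare x → ¬IsSquare (-x) := fun x hx hs => by
    simpa using not_isSquare_mul hs hx hm
  have neg_s : ∀ x : ZMod p, ¬IsSquare x → IsSquare (-x) := fun x hs => by
    simpa using isSquare_mul_of_not_isSquare hs hm
  have w1 : W 1 = a := by simpa using ha 1 one_ne_zero IsSquare.one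
  have wm : W (-1) = -b := by linear_combination -(hb (-1) hm)
  have hsum : b = -1 - a := by
    have := hR 0
    rw [h0, zero_sub, zero_add, wm, w1] at this
    linear_combination -this
  have sq_ne : ∀ x : ZMod p, x ^ 2 ≠ -1 := fun x h => hm ⟨x, by rw [← h, sq]⟩
  have r2 := hR' 2
  rw [show (2 : ZMod p) - 1 = 1 by norm_num, w1] at r2
  by_cases s2 : IsSquare (2 : ZMod p)
  · have w2 := ha 2 h2 s2
    have hs4 : IsSquare (4 : ZMod p) := ⟨2, by norm_num⟩
    have h4 : (4 : ZMod p) ≠ 0 := by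
      rw [show (4 : ZMod p) = 2 * 2 by norm_num]; exact mul_ne_zero h2 h2
    have key : a = 2 ∨ a = -3 := by
      by_cases hy : W 2 + 1 = 0
      · rw [hy, h0] at r2
        exact absurd (by linear_combination 2 * hy - w2 + r2) h3
      · have hc := hab _ hy
        rw [r2] at hc
        rcases hc with hc | hc
        · left
          have : (a + 1) * (a - 2) = 0 := by linear_combination 2 * hc - (a - 1) * w2
          rcases mul_eq_zero.1 this with h | h
          · exact absurd (by rwa [eq_neg_of_add_eq_zero_left h] at hsa) hm
          · linear_combination h
        · right
          have : a * (a + 3) = 0 := by linear_combination 2 * hc - (a - 1) * w2 + 2 * hsum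
          rcases mul_eq_zero.1 this with h | h
          · exact absurd (by rw [hsum, h, sub_zero] at hsb; exact hsb) hm
          · linear_combination h
    rcases key with rfl | rfl
    · have hb3 : b = -3 := by rw [hsum]; norm_num
      subst hb3
      have r5 := hR' 5
      have w4 := ha 4 h4 hs4
      rw [show (5 : ZMod p) - 1 = 4 by norm_num] at r5
      by_cases s5 : IsSquare (5 : ZMod p)
      · have w5 := ha 5 h5 s5
        have hy : W 5 + 1 ≠ 0 := fun h => h7 (by linear_combination 5 * h - w5)
        have hc := hab _ hy
        rw [r5] at hc
        rcases hc with hc | hc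
        · exact mul_ne_zero h2 (pow_ne_zero 3 h3) (by
            linear_combination (-20) * hc + 4 * (W 4 - 1) * w5 + 7 * w4)
        · refine h23 ((mul_eq_zero.1 (?_ : (2 : ZMod p) * 23 = 0)).resolve_left h2) s5
          linear_combination 20 * hc - 4 * (W 4 - 1) * w5 - 7 * w4
      · have w5 := hb 5 s5
        have sy : ¬IsSquare (W 5 + 1) := fun h => by
          have := not_isSquare_mul h (fun h => h2 (by linear_combination 5 * h - w5)) s5
          exact this (by rwa [show (W 5 + 1) * 5 = 2 by linear_combination w5])
        have hc := hb _ sy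
        rw [r5] at hc
        exact mul_ne_zero (mul_ne_zero h2 h4) h7 (by
          linear_combination 20 * hc - 4 * (W 4 - 1) * w5 - 2 * w4)
    · have hb2 : b = 2 := by rw [hsum]; norm_num
      subst hb2
      have r5 := hR (-5)
      have w4 := hb (-4) (neg_ns 4 h4 hs4)
      rw [show (-5 : ZMod p) + 1 = -4 by norm_num] at r5
      by_cases s5 : IsSquare (5 : ZMod p)
      · have w5 := hb (-5) (neg_ns 5 h5 s5)
        have hy : W (-5) - 1 ≠ 0 := fun h => h7 (by linear_combination (-5) * h - w5)
        have hc := hab _ hy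
        rw [r5] at hc
        rcases hc with hc | hc
        · refine h23 ((mul_eq_zero.1 (?_ : (2 : ZMod p) * 23 = 0)).resolve_left h2) s5
          linear_combination 20 * hc + 4 * (W (-4) + 1) * w5 - 7 * w4
        · exact mul_ne_zero h2 (pow_ne_zero 3 h3) (by
            linear_combination (-20) * hc - 4 * (W (-4) + 1) * w5 + 7 * w4)
      · have w5 := ha (-5) (neg_ne_zero.2 h5) (neg_s 5 s5)
        have hy : W (-5) - 1 ≠ 0 := fun h => h2 (by linear_combination -w5 - 5 * h)
        have sy : IsSquare (W (-5) - 1) := by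
          by_contra h
          have := isSquare_mul_of_not_isSquare h s5
          rw [show (W (-5) - 1) * 5 = -2 by linear_combination -w5] at this
          exact neg_ns 2 h2 s2 this
        have hc := ha _ hy sy
        rw [r5] at hc
        exact mul_ne_zero (mul_ne_zero h2 h4) h7 (by
          linear_combination 20 * hc + 4 * (W (-4) + 1) * w5 - 2 * w4)
  · have w2 := hb 2 s2
    have s2' := neg_s _ s2
    have w2' := ha (-2) (neg_ne_zero.2 h2) s2'
    have r2' := hR (-2)
    rw [show (-2 : ZMod p) + 1 = -1 by norm_num, wm] at r2'
    have key : b = -2 ∨ b ^ 2 + 6 * b + 4 = 0 := by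
      by_cases hy : W 2 + 1 = 0
      · left
        linear_combination 2 * hy - w2
      · have hc := hab _ hy
        rw [r2] at hc
        rcases hc with hc | hc
        · exact absurd (by linear_combination (-2) * hc + (a - 1) * w2 + b * hsum)
            (sq_ne (b + 1))
        · right
          linear_combination (-2) * hc + (a - 1) * w2 + (b + 2) * hsum
    have key' : a = -2 ∨ a ^ 2 + 6 * a + 4 = 0 := by
      by_cases hy : W (-2) - 1 = 0
      · left
        linear_combination (-2) * hy - w2'
      · have hc := hab _ hy
        rw [r2'] at hc
        rcases hc with hc | hc
        · right
          linear_combination (-2) * hc - (1 - b) * w2' + (a + 2) * hsum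
        · exact absurd (by linear_combination (-2) * hc - (1 - b) * w2' + a * hsum)
            (sq_ne (a + 1))
    rcases key with rfl | hqb
    · have ha1 : a = 1 := by linear_combination hsum
      subst ha1
      rcases key' with h | h
      · exact h3 (by linear_combination h)
      · exact h11 (by linear_combination h)
    · rcases key' with rfl | h
      · have hb1 : b = 1 := by rw [hsum]; norm_num
        subst hb1
        exact h11 (by linear_combination hqb)
      · subst hsum
        have hd : 5 * (2 * a + 1) = 0 := by linear_combination h - hqb
        have h2a := (mul_eq_zero.1 hd).resolve_left h5
        exact h5 (by linear_combination 4 * h - (2 * a + 11) * h2a)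

/-- Galois's computation: for a prime `p ≥ 13` no function on `ZMod p` behaves like the Weyl element
in an action of `SL(2, ZMod p)` on `p` points. -/
lemma false_of_weyl_relations (h13 : 13 ≤ p) {W : ZMod p → ZMod p} (h0 : W 0 = 0)
    (hWW : ∀ x, W (W x) = x)
    (hT : ∀ (t : (ZMod p)ˣ) (x : ZMod p), (t : ZMod p) ^ 2 * W ((t : ZMod p) ^ 2 * x) = W x)
    (hR : ∀ (s : (ZMod p)ˣ) (x : ZMod p),
      (s : ZMod p) * W ((s : ZMod p) ^ 2 * W x - s) = s * W (x + s) + 1) : False := by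
  have h2 : ((2 : ℕ) : ZMod p) ≠ 0 := natCast_ne_zero_of_lt (by omega) (by omega)
  push_cast at h2
  have hR1 : ∀ x, W (W x - 1) = W (x + 1) + 1 := fun x => by simpa using hR 1 x
  have hR1' : ∀ x, W (W x + 1) = W (x - 1) - 1 := fun x => by
    have := hR (-1) x
    simp only [Units.val_neg, Units.val_one, neg_one_sq, one_mul, sub_neg_eq_add,
      ← sub_eq_add_neg] at this
    linear_combination -this
  have hsq : ∀ x y : ZMod p, x ≠ 0 → IsSquare x → x * y * W (x * y) = y * W y := by
    rintro x y hx ⟨t, rfl⟩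
    have := hT (Units.mk0 t (left_ne_zero_of_mul hx)) y
    rw [Units.val_mk0, sq] at this
    linear_combination y * this
  have ha : ∀ x, x ≠ 0 → IsSquare x → x * W x = W 1 := fun x hx hs => by
    simpa using hsq x 1 hx hs
  have hns : ∀ n x : ZMod p, ¬IsSquare n → ¬IsSquare x → x * W x = n * W n := fun n x hn hx => by
    have hn0 : n ≠ 0 := fun h => hn (h ▸ IsSquare.zero)
    have hx0 : x ≠ 0 := fun h => hx (h ▸ IsSquare.zero)
    have hs : IsSquare (x / n) := by
      have := (isSquare_mul_of_not_isSquare hx hn).div (IsSquare.mul_self n)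
      rwa [mul_div_mul_right _ _ hn0] at this
    simpa [div_mul_cancel₀ _ hn0] using hsq (x / n) n (div_ne_zero hx0 hn0) hs
  have hconst : ∀ n : ZMod p, ¬IsSquare n → n * W n = W 1 → False := fun n hn h =>
    false_of_mul_eq_const h13 h0 (fun x hx => by
      by_cases hs : IsSquare x
      · exact ha x hx hs
      · rw [hns n x hn hs, h]) hR1
  have e0 := hR1 0
  rw [h0, zero_sub, zero_add] at e0
  by_cases hm : IsSquare (-1 : ZMod p)
  · obtain ⟨n, hn⟩ := FiniteField.exists_nonsquare (F := ZMod p) (by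
      rw [ZMod.ringChar_zmod_n]; omega)
    have hn0 : n ≠ 0 := fun h => hn (h ▸ IsSquare.zero)
    refine hconst n hn (mul_left_cancel₀ h2 ?_)
    have em := ha (-1) (neg_ne_zero.2 one_ne_zero) hm
    have en := hsq (-1) n (neg_ne_zero.2 one_ne_zero) hm
    have eR := hR (Units.mk0 n hn0) 0
    simp only [Units.val_mk0, h0, mul_zero, zero_sub, zero_add] at eR
    rw [neg_one_mul] at en
    linear_combination -en - eR + em + e0
  · have hb := fun x hx => hns (-1) x hm hx
    set a := W 1 with haW
    set b := -1 * W (-1) with hbW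
    have ha0 : a ≠ 0 := fun h => one_ne_zero (α := ZMod p) (by rw [← hWW 1, ← haW, h, h0])
    have hb0 : b ≠ 0 := fun h => one_ne_zero (α := ZMod p) (by
      have h' : W (-1) = 0 := by linear_combination -h
      have := hWW (-1)
      rw [h', h0] at this
      linear_combination this)
    by_cases hsa : IsSquare a
    · by_cases hsb : IsSquare b
      · exact false_of_neg_one_not_isSquare h13 hm h0 hsa hsb ha hb hR1 hR1'
      · refine hconst (-1) hm ?_
        have hs := isSquare_mul_of_not_isSquare hm hsb
        have h' : -1 * b = W (-1) := by rw [hbW]; ring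
        have := ha _ (mul_ne_zero (neg_ne_zero.2 one_ne_zero) hb0) hs
        rw [h', hWW] at this
        linear_combination this
    · refine hconst (-1) hm ?_
      have := hb a hsa
      rw [haW, hWW] at this
      linear_combination -this

end Arithmetic

section Action

variable {p : ℕ} [Fact p.Prime]

lemma unip_smul_eq_of_ne_zero {X : Type*} [MulAction SL(2, ZMod p) X] {x : X} {d : ZMod p}
    (hd : d ≠ 0) (h : unip d • x = x) (s : ZMod p) : unip s • x = x := by
  have hn : ∀ n : ℕ, unip (n * d) • x = x := fun n => by
    induction n with
    | zero => simp [unip_zero]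
    | succ k ih => rw [Nat.cast_succ, add_one_mul, unip_add, mul_smul, h, ih]
  simpa [div_mul_cancel₀ _ hd] using hn (s / d).val

lemma unip_smul_injective {X : Type*} [MulAction SL(2, ZMod p) X] {x : X} {s : ZMod p}
    (h : unip s • x ≠ x) : Function.Injective fun r : ZMod p => unip r • x := by
  intro r r' hr
  by_contra hne
  refine h (unip_smul_eq_of_ne_zero (sub_ne_zero.2 hne) ?_ s)
  have : unip r' • unip (r - r') • x = unip r' • x := by
    rw [← mul_smul, ← unip_add, add_sub_cancel]
    exact hr
  exact smul_left_cancel _ this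

/-- For a prime `p ≥ 13`, every action of `SL(2, ZMod p)` on at most `p` points is trivial. -/
theorem smul_eq_of_card_le (h13 : 13 ≤ p) {X : Type*} [Finite X] [MulAction SL(2, ZMod p) X]
    (hX : Nat.card X ≤ p) (g : SL(2, ZMod p)) (x : X) : g • x = x := by
  refine smul_eq_of_unip_smul_eq (fun s x₀ => ?_) g x
  by_contra hs
  have bij : ∀ (y : X) (r : ZMod p), unip r • y ≠ y →
      Function.Bijective fun r : ZMod p => unip r • y := fun y r hr =>
    (Nat.bijective_iff_injective_and_card _).2 ⟨unip_smul_injective hr, le_antisymm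
      (Nat.card_le_card_of_injective _ (unip_smul_injective hr)) (by simpa using hX)⟩
  have hφ := bij x₀ s hs
  -- `torus 2` acts by an affine map of slope `4`, hence has a unique fixed point `y`
  have h2 : ((2 : ℕ) : ZMod p) ≠ 0 := natCast_ne_zero_of_lt (by omega) (by omega)
  have h3 : ((3 : ℕ) : ZMod p) ≠ 0 := natCast_ne_zero_of_lt (by omega) (by omega)
  push_cast at h2 h3
  set t₀ : (ZMod p)ˣ := Units.mk0 2 h2 with ht₀
  obtain ⟨r, hr⟩ := hφ.2 (torus t₀ • x₀)
  have htφ : ∀ z, torus t₀ • unip z • x₀ = unip (4 * z + r) • x₀ := fun z => by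
    rw [← mul_smul, torus_mul_unip, mul_smul, ← hr, ← mul_smul, ← unip_add, ht₀, Units.val_mk0]
    norm_num
  have hfix : ∀ z, torus t₀ • unip z • x₀ = unip z • x₀ ↔ z = -r / 3 := fun z => by
    rw [htφ, hφ.1.eq_iff, eq_div_iff h3]
    constructor <;> intro h <;> linear_combination h
  have huniq : ∀ y y' : X, torus t₀ • y = y → torus t₀ • y' = y' → y = y' := fun y y' hy hy' => by
    obtain ⟨z, rfl⟩ := hφ.2 y
    obtain ⟨z', rfl⟩ := hφ.2 y'
    rw [(hfix z).1 hy, (hfix z').1 hy']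
  obtain ⟨y, hy⟩ : ∃ y : X, torus t₀ • y = y := ⟨_, (hfix _).2 rfl⟩
  have hTy : ∀ t : (ZMod p)ˣ, torus t • y = y := fun t =>
    huniq _ _ (by rw [← mul_smul, torus_mul_comm, mul_smul, hy]) hy
  have hwy : (weyl : SL(2, ZMod p)) • y = y :=
    huniq _ _ (by rw [← mul_smul, torus_mul_weyl, mul_smul, hTy]) hy
  have hψ : Function.Bijective fun r : ZMod p => unip r • y := by
    by_cases h : unip (1 : ZMod p) • y = y
    · obtain ⟨z, hz⟩ := hφ.2 y
      have := unip_smul_eq_of_ne_zero one_ne_zero h (-z)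
      rw [← hz] at this
      simp only [← mul_smul, ← unip_add, neg_add_cancel, unip_zero, one_smul] at this
      obtain rfl : x₀ = y := this.trans hz
      exact absurd (unip_smul_eq_of_ne_zero one_ne_zero h s) hs
    · exact bij y 1 h
  have hTψ : ∀ (t : (ZMod p)ˣ) z, torus t • unip z • y = unip ((t : ZMod p) ^ 2 * z) • y :=
    fun t z => by rw [← mul_smul, torus_mul_unip, mul_smul, hTy]
  choose W hW using fun z : ZMod p => hψ.2 ((weyl : SL(2, ZMod p)) • unip z • y)
  simp only at hW
  refine false_of_weyl_relations h13 (W := W) (hψ.1 ?_) (fun z => hψ.1 ?_)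
    (fun t z => hψ.1 ?_) (fun t z => ?_)
  · simp only [hW, unip_zero, one_smul, hwy]
  · simp only [hW]
    rw [← mul_smul, weyl_mul_weyl, hTψ]
    simp
  · simp only
    rw [← hTψ, hW, ← hTψ, ← mul_smul, ← mul_smul, torus_mul_weyl, mul_assoc,
      torus_inv_mul_torus, mul_one, hW]
  · have h := congrArg (· • unip z • y) (unip_weyl_unip t)
    simp only [mul_smul] at h
    rw [← hW z, hTψ, ← mul_smul (unip (-(t : ZMod p))), ← unip_add, ← hW, hTψ,
      ← mul_smul (unip (t : ZMod p)) (unip z), ← unip_add, ← hW, hTψ, ← mul_smul, ← unip_add] at h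
    have h' := hψ.1 h
    rw [neg_add_eq_sub, add_comm _ z] at h'
    refine mul_left_cancel₀ t.ne_zero ?_
    linear_combination -h'

end Action

end SL2Degree

/-- The stabilizer of a point of the projective line has index `p + 1` in `PSL(2, ZMod p)`. -/
lemma PSL2_exists_index_eq (p : ℕ) (hp : p.Prime) :
    ∃ H : Subgroup PSL(2, ZMod p), H ≠ ⊤ ∧ H.index = p + 1 := by
  have : Fact p.Prime := ⟨hp⟩
  let P : ℙ (ZMod p) (Fin 2 → ZMod p) := .mk _ (Pi.single 0 1) (by simp)
  have h : (MulAction.stabilizer PSL(2, ZMod p) P).index = p + 1 := by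
    rw [MulAction.index_stabilizer_of_transitive, Projectivization.card_of_finrank_two]
    · simp
    · simp
  refine ⟨_, fun ht => ?_, h⟩
  rw [ht, Subgroup.index_top] at h
  have := hp.pos
  omega

/-- For a prime `p ≥ 13`, every proper subgroup of `PSL₂(𝔽_p)` has index at least
`p + 1`, and there is a (proper) subgroup of index exactly `p + 1`; that is, the
minimal index of a proper subgroup of `PSL₂(𝔽_p)` equals `p + 1`. -/
theorem PSL2_minimal_index (p : ℕ) (hp : p.Prime) (h13 : 13 ≤ p) :
    (∀ H : Subgroup (Matrix.SpecialLinearGroup (Fin 2) (ZMod p) ⧸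
        Subgroup.center (Matrix.SpecialLinearGroup (Fin 2) (ZMod p))),
      H ≠ ⊤ → p + 1 ≤ H.index) ∧
    (∃ H : Subgroup (Matrix.SpecialLinearGroup (Fin 2) (ZMod p) ⧸
        Subgroup.center (Matrix.SpecialLinearGroup (Fin 2) (ZMod p))),
      H ≠ ⊤ ∧ H.index = p + 1) := by
  have : Fact p.Prime := ⟨hp⟩
  refine ⟨fun H hH => ?_, PSL2_exists_index_eq p hp⟩
  by_contra! hlt
  have hK : (H.comap (QuotientGroup.mk' (Subgroup.center SL(2, ZMod p)))).index = H.index :=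
    Subgroup.index_comap_of_surjective _ (QuotientGroup.mk'_surjective _)
  have htriv := SL2Degree.smul_eq_of_card_le h13
    (X := SL(2, ZMod p) ⧸ H.comap (QuotientGroup.mk' (Subgroup.center SL(2, ZMod p))))
    (by rw [← Subgroup.index_eq_card, hK]; omega)
  refine hH ((Subgroup.eq_top_iff' H).2 fun x => ?_)
  obtain ⟨g, rfl⟩ := QuotientGroup.mk'_surjective _ x
  have hg := htriv g ((1 : SL(2, ZMod p)) : SL(2, ZMod p) ⧸ _)
  rw [MulAction.Quotient.smul_mk, smul_eq_mul, mul_one, eq_comm, QuotientGroup.eq] at hg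
  simpa using hg
end

section
/- For every prime p, every subgroup of PSL₂(F_p) can be generated by at most 2 elements; that is, the rank of PSL₂(F_p) is at most 2. -/
section TwoFixedPoints

open MulAction

/-- The solutions of the orbit equation with three non-free orbits, of lengths `m₁`, `m₂`, `m₃`
and with point stabilizers of orders `e₁`, `e₂`, `e₃`. -/
lemma eq_of_orbit_lengths_add_eq {n m₁ m₂ m₃ e₁ e₂ e₃ : ℕ} (h₁ : m₁ * e₁ = n) (h₂ : m₂ * e₂ = n)
    (h₃ : m₃ * e₃ = n) (hsum : m₁ + m₂ + m₃ = n + 2) (he₁ : 2 ≤ e₁) (he₂ : 2 ≤ e₂)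
    (h₁₃ : e₁ ≤ e₃) (h₂₃ : e₂ ≤ e₃) :
    n = 2 * e₃ ∨ (n = 12 ∧ e₃ = 3) ∨ (n = 24 ∧ e₃ = 4) ∨ (n = 60 ∧ e₃ = 5) := by
  wlog h₁₂ : e₁ ≤ e₂ generalizing m₁ m₂ e₁ e₂
  · exact this h₂ h₁ (by omega) he₂ he₁ h₂₃ h₁₃ (by omega)
  have b₁ : e₁ = 2 := by
    by_contra h
    have c₁ : m₁ * 3 ≤ n := h₁ ▸ Nat.mul_le_mul_left _ (by omega)
    have c₂ : m₂ * 3 ≤ n := h₂ ▸ Nat.mul_le_mul_left _ (by omega)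
    have c₃ : m₃ * 3 ≤ n := h₃ ▸ Nat.mul_le_mul_left _ (by omega)
    omega
  subst b₁
  have b₂ : e₂ < 4 := by
    by_contra h
    have c₂ : m₂ * 4 ≤ n := h₂ ▸ Nat.mul_le_mul_left _ (by omega)
    have c₃ : m₃ * 4 ≤ n := h₃ ▸ Nat.mul_le_mul_left _ (by omega)
    omega
  interval_cases e₂
  · obtain rfl : m₃ = 2 := by omega
    omega
  · have b₃ : e₃ < 6 := by
      by_contra h
      have c₃ : m₃ * 6 ≤ n := h₃ ▸ Nat.mul_le_mul_left _ (by omega)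
      omega
    interval_cases e₃ <;> omega

variable {G X : Type*} [Group G] [Finite X] [MulAction G X]

/-- Burnside's orbit count for an action in which every nontrivial element has exactly two
fixed points. -/
lemma sum_card_sub_index_stabilizer [Finite G] [Fintype (orbitRel.Quotient G X)]
    (hfix : ∀ g : G, g ≠ 1 → (fixedBy X g).ncard = 2) :
    ∑ ω : orbitRel.Quotient G X, ((Nat.card G : ℤ) - (stabilizer G ω.out).index) =
      2 * Nat.card G - 2 := by
  classical
  have := Fintype.ofFinite G
  have := Fintype.ofFinite X
  have h₁ := sum_card_fixedBy_eq_card_orbits_mul_card_group G X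
  have h₂ : Fintype.card X = ∑ ω : orbitRel.Quotient G X, (stabilizer G ω.out).index := by
    rw [Fintype.card_congr (selfEquivSigmaOrbits G X), Fintype.card_sigma]
    refine Finset.sum_congr rfl fun ω _ => ?_
    rw [index_stabilizer, Set.ncard_eq_toFinset_card', Set.toFinset_card]
  have h₃ : ∑ g : G, Fintype.card (fixedBy X g) = Fintype.card X + (Fintype.card G - 1) * 2 := by
    rw [← Finset.add_sum_erase _ _ (Finset.mem_univ (1 : G))]
    congr 1
    · refine Fintype.card_congr ((Equiv.setCongr ?_).trans (Equiv.Set.univ X))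
      ext; simp
    · rw [Finset.sum_const_nat (m := 2), Finset.card_erase_of_mem (Finset.mem_univ _),
        Finset.card_univ]
      intro g hg
      rw [← hfix g (Finset.ne_of_mem_erase hg), Set.ncard_eq_toFinset_card', Set.toFinset_card]
  have h₄ : 0 < Fintype.card G := Fintype.card_pos
  rw [h₃, h₂] at h₁
  zify [h₄] at h₁
  rw [Finset.sum_sub_distrib, Finset.sum_const, Finset.card_univ, Nat.card_eq_fintype_card,
    nsmul_eq_mul]
  change _ = (Fintype.card (orbitRel.Quotient G X) : ℤ) * _ at h₁
  linarith

/-- A finite group in which every nontrivial element has exactly two fixed points is a point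
stabilizer, has a point stabilizer of index two, or has one of the orders `12`, `24`, `60`. -/
lemma exists_stabilizer_of_ncard_fixedBy_eq_two [Finite G] [Nontrivial G]
    (hfix : ∀ g : G, g ≠ 1 → (fixedBy X g).ncard = 2) :
    ∃ x : X, (∀ y : X, Nat.card (stabilizer G y) ≤ Nat.card (stabilizer G x)) ∧
      (Nat.card G = Nat.card (stabilizer G x) ∨ Nat.card G = 2 * Nat.card (stabilizer G x) ∨
        (Nat.card G = 12 ∧ Nat.card (stabilizer G x) = 3) ∨
        (Nat.card G = 24 ∧ Nat.card (stabilizer G x) = 4) ∨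
        (Nat.card G = 60 ∧ Nat.card (stabilizer G x) = 5)) := by
  classical
  have := Fintype.ofFinite (orbitRel.Quotient G X)
  obtain ⟨g₀, hg₀⟩ := exists_ne (1 : G)
  obtain ⟨x₀, hx₀⟩ : (fixedBy X g₀).Nonempty := by
    rw [← Set.ncard_pos, hfix g₀ hg₀]; norm_num
  have : Nonempty X := ⟨x₀⟩
  obtain ⟨x, hx⟩ := Finite.exists_max fun y : X => Nat.card (stabilizer G y)
  refine ⟨x, hx, ?_⟩
  set n := Nat.card G with hn
  set m : orbitRel.Quotient G X → ℕ := fun ω => (stabilizer G ω.out).index with hm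
  set e : orbitRel.Quotient G X → ℕ := fun ω => Nat.card (stabilizer G ω.out) with he
  have hme : ∀ ω, m ω * e ω = n := fun ω => by rw [mul_comm]; exact Subgroup.card_mul_index _
  have hepos : ∀ ω, 0 < e ω := fun ω => Nat.card_pos
  have hn1 : 1 < n := Finite.one_lt_card
  have hmpos : ∀ ω, 0 < m ω := fun ω => Nat.pos_of_ne_zero fun h => by
    have := hme ω; rw [h] at this; omega
  set T : Finset (orbitRel.Quotient G X) := Finset.univ.filter fun ω => 2 ≤ e ω with hT
  have hsum : ∑ ω ∈ T, ((n : ℤ) - m ω) = 2 * n - 2 := by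
    rw [← sum_card_sub_index_stabilizer hfix, hT]
    refine Finset.sum_filter_of_ne fun ω _ h => ?_
    by_contra h'
    have h1 : e ω = 1 := by have := hepos ω; omega
    have := hme ω
    rw [h1, mul_one] at this
    exact h (by rw [sub_eq_zero]; exact_mod_cast this.symm)
  have hTe : ∀ ω ∈ T, 2 ≤ e ω := fun ω h => (Finset.mem_filter.1 h).2
  have hTm : ∀ ω ∈ T, 2 * m ω ≤ n := fun ω h => by
    rw [← hme ω, mul_comm]; exact Nat.mul_le_mul_left _ (hTe ω h)
  have hex : ∀ ω, e ω ≤ Nat.card (stabilizer G x) := fun ω => hx _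
  have hxe : e ⟦x⟧ = Nat.card (stabilizer G x) := by
    obtain ⟨g, hg⟩ : (⟦x⟧ : orbitRel.Quotient G X).out ∈ orbit G x := by
      rw [← orbitRel_apply]; exact Quotient.mk_out x
    exact (Nat.card_congr (stabilizerEquivStabilizer hg.symm).toEquiv).symm
  have hxT : (⟦x⟧ : orbitRel.Quotient G X) ∈ T := by
    refine Finset.mem_filter.2 ⟨Finset.mem_univ _, ?_⟩
    rw [hxe]
    refine le_trans ?_ (hx x₀)
    have : Nontrivial (stabilizer G x₀) :=
      ⟨⟨⟨g₀, hx₀⟩, 1, fun h => hg₀ (congrArg Subtype.val h)⟩⟩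
    exact Finite.one_lt_card
  have hle : T.card ≤ 3 := by
    have : (T.card : ℤ) * n ≤ 2 * (2 * n - 2) := by
      rw [← hsum, Finset.mul_sum, ← nsmul_eq_mul]
      refine Finset.card_nsmul_le_sum _ _ _ fun ω h => ?_
      have := hTm ω h
      zify at this
      linarith
    by_contra! h
    have h4 : (4 : ℤ) ≤ T.card := by exact_mod_cast h
    nlinarith
  have hge : 2 ≤ T.card := by
    have : 2 * (n : ℤ) - 2 ≤ T.card * (n - 1) := by
      rw [← hsum, ← nsmul_eq_mul]
      refine Finset.sum_le_card_nsmul _ _ _ fun ω h => ?_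
      have := hmpos ω
      zify at this
      linarith
    by_contra! h
    have h4 : (T.card : ℤ) ≤ 1 := by exact_mod_cast (by omega : T.card ≤ 1)
    nlinarith
  rw [← hxe] at hex ⊢
  interval_cases hc : T.card
  · left
    obtain ⟨a, b, hab, hTab⟩ := Finset.card_eq_two.1 hc
    rw [hTab, Finset.sum_pair hab] at hsum
    have ha := hmpos a
    have hb := hmpos b
    have h1 : m ⟦x⟧ = 1 := by
      rw [hTab, Finset.mem_insert, Finset.mem_singleton] at hxT
      rcases hxT with h | h <;> rw [h] <;> omega
    rw [← hme ⟦x⟧, h1, one_mul]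
  · right
    obtain ⟨a, b, c, hab, hac, hbc, hTabc⟩ := Finset.card_eq_three.1 hc
    rw [hTabc, Finset.sum_insert (by simp [hab, hac]), Finset.sum_pair hbc] at hsum
    have ea := hTe a (by simp [hTabc])
    have eb := hTe b (by simp [hTabc])
    have ec := hTe c (by simp [hTabc])
    rw [hTabc, Finset.mem_insert, Finset.mem_insert, Finset.mem_singleton] at hxT
    rcases hxT with h | h | h <;> rw [h] at hex ⊢
    · exact eq_of_orbit_lengths_add_eq (hme b) (hme c) (hme a) (by omega) eb ec (hex b) (hex c)
    · exact eq_of_orbit_lengths_add_eq (hme a) (hme c) (hme b) (by omega) ea ec (hex a) (hex c)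
    · exact eq_of_orbit_lengths_add_eq (hme a) (hme b) (hme c) (by omega) ea eb (hex a) (hex b)

/-- Two point stabilizers meet trivially if one of them is cyclic with a generator that moves
the other point. -/
lemma disjoint_stabilizer_of_smul_ne (hfix : ∀ g : G, g ≠ 1 → (fixedBy X g).ncard = 2) {x y : X}
    {a : G} (ha : Subgroup.zpowers a = stabilizer G x) (hy : a • y ≠ y) :
    Disjoint (stabilizer G x) (stabilizer G y) := by
  rw [Subgroup.disjoint_def]
  intro h hx hhy
  by_contra h1
  have hax : a • x = x := by
    rw [← mem_stabilizer_iff, ← ha]; exact Subgroup.mem_zpowers a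
  have hxy : x ≠ y := by rintro rfl; exact hy hax
  have hF : fixedBy X h = {x, y} := by
    refine (Set.eq_of_subset_of_ncard_le ?_ ?_ (Set.toFinite _)).symm
    · rintro z (rfl | rfl)
      · exact hx
      · exact hhy
    · rw [hfix h h1, Set.ncard_pair hxy]
  have hcomm : a * h = h * a := by
    rw [← ha, Subgroup.mem_zpowers_iff] at hx
    obtain ⟨k, rfl⟩ := hx
    exact (Commute.refl a).zpow_right k
  have hay : a • y ∈ fixedBy X h := by
    rw [mem_fixedBy, ← mul_smul, ← hcomm, mul_smul, mem_stabilizer_iff.1 hhy]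
  rw [hF] at hay
  rcases hay with h | h
  · exact hxy (smul_left_cancel a (hax.trans h.symm))
  · exact hy h

/-- The order of a group is at least the product of the orders of two subgroups that meet
trivially. -/
lemma card_mul_card_le_of_disjoint {G : Type*} [Group G] [Finite G] {A B L : Subgroup G}
    (h : Disjoint A B) (hA : A ≤ L) (hB : B ≤ L) : Nat.card A * Nat.card B ≤ Nat.card L := by
  rw [← Nat.card_prod]
  refine Nat.card_le_card_of_injective
    (fun g : A × B => (⟨g.1 * g.2, L.mul_mem (hA g.1.2) (hB g.2.2)⟩ : L)) fun g k hgk => ?_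
  exact Subgroup.mul_injective_of_disjoint h (congrArg Subtype.val hgk)

/-- A finite group acting with cyclic point stabilizers, such that every nontrivial element has
exactly two fixed points, is generated by two elements. -/
theorem exists_closure_pair_eq_top_of_ncard_fixedBy_eq_two [Finite G]
    (hfix : ∀ g : G, g ≠ 1 → (fixedBy X g).ncard = 2)
    (hcyc : ∀ x : X, IsCyclic (stabilizer G x)) :
    ∃ a b : G, Subgroup.closure {a, b} = ⊤ := by
  rcases subsingleton_or_nontrivial G with hG | hG
  · exact ⟨1, 1, Subsingleton.elim _ _⟩
  have hgen : ∀ x : X, ∃ a : G, Subgroup.zpowers a = stabilizer G x := fun x =>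
    (Subgroup.isCyclic_iff_exists_zpowers_eq_top _).1 (hcyc x)
  obtain ⟨x, hmax, hx⟩ := exists_stabilizer_of_ncard_fixedBy_eq_two hfix
  obtain ⟨a, ha⟩ := hgen x
  have hpair : ∀ (b : G) (y : X), Subgroup.zpowers b = stabilizer G y →
      stabilizer G y ≤ Subgroup.closure {a, b} := fun b y h => by
    rw [← h, Subgroup.zpowers_le]; exact Subgroup.subset_closure (by simp)
  have hxL : ∀ b, stabilizer G x ≤ Subgroup.closure {a, b} := fun b => by
    rw [← ha, Subgroup.zpowers_le]; exact Subgroup.subset_closure (by simp)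
  by_cases htop : stabilizer G x = ⊤
  · exact ⟨a, 1, top_le_iff.1 (htop ▸ hxL 1)⟩
  have hcard : Nat.card G ≠ Nat.card (stabilizer G x) := fun h =>
    htop (Subgroup.eq_top_of_card_eq _ h.symm)
  rcases hx.resolve_left hcard with hx | hx
  · obtain ⟨b, hb⟩ : ∃ b, b ∉ stabilizer G x := by
      by_contra! h; exact htop (Subgroup.eq_top_iff' _ |>.2 h)
    refine ⟨a, b, ?_⟩
    have hlt : stabilizer G x < Subgroup.closure {a, b} :=
      SetLike.lt_iff_le_and_exists.2 ⟨hxL b, b, Subgroup.subset_closure (by simp), hb⟩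
    by_contra hne
    obtain ⟨k, hk⟩ := (Subgroup.closure {a, b}).card_subgroup_dvd_card
    obtain ⟨l, hl⟩ := Subgroup.card_dvd_of_le hlt.le
    have hpos : 0 < Nat.card (stabilizer G x) := Nat.card_pos
    have hk1 : k ≠ 1 := by
      rintro rfl; exact hne (Subgroup.eq_top_of_card_eq _ (by omega))
    have hl1 : l ≠ 1 := by
      rintro rfl
      exact hlt.ne (Subgroup.eq_of_le_of_card_ge hlt.le (by omega))
    rw [hl, hx, mul_assoc, mul_comm 2] at hk
    have h2 : 2 = l * k := Nat.eq_of_mul_eq_mul_left hpos hk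
    rcases (Nat.dvd_prime Nat.prime_two).1 ⟨k, h2⟩ with h | h
    · exact hl1 h
    · rw [h] at h2; omega
  · have horb : 2 < (orbit G x).ncard := by
      have := (stabilizer G x).card_mul_index
      rw [index_stabilizer] at this
      rcases hx with ⟨h, h'⟩ | ⟨h, h'⟩ | ⟨h, h'⟩ <;> rw [h, h'] at this <;> omega
    have ha1 : a ≠ 1 := by
      rintro rfl
      rw [Subgroup.zpowers_one_eq_bot] at ha
      rw [← ha, Subgroup.card_bot] at hx
      omega
    obtain ⟨y, hyx, hy⟩ := Set.exists_mem_notMem_of_ncard_lt_ncard ((hfix a ha1).trans_lt horb)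
    obtain ⟨b, hb⟩ := hgen y
    refine ⟨a, b, ?_⟩
    have hye : Nat.card (stabilizer G y) = Nat.card (stabilizer G x) := by
      obtain ⟨g, hg⟩ := hyx
      exact (Nat.card_congr (stabilizerEquivStabilizer hg.symm).toEquiv).symm
    have hle := card_mul_card_le_of_disjoint (disjoint_stabilizer_of_smul_ne hfix ha hy)
      (hxL b) (hpair b y hb)
    obtain ⟨k, hk⟩ := (Subgroup.closure {a, b}).card_subgroup_dvd_card
    set L := Subgroup.closure {a, b} with hL
    rw [hye] at hle
    have hLpos : 0 < Nat.card L := Nat.card_pos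
    apply Subgroup.eq_top_of_card_eq
    by_contra hne
    have hk1 : k ≠ 1 := by rintro rfl; omega
    have hk0 : k ≠ 0 := by rintro rfl; omega
    have hk2 : Nat.card L * 2 ≤ Nat.card G := hk ▸ Nat.mul_le_mul_left _ (by omega)
    rcases hx with ⟨h, h'⟩ | ⟨h, h'⟩ | ⟨h, h'⟩ <;> rw [h'] at hle <;> try omega
    have hk3 : k < 3 := by
      by_contra h3
      have : Nat.card L * 3 ≤ Nat.card G := hk ▸ Nat.mul_le_mul_left _ (by omega)
      omega
    obtain rfl : k = 2 := by omega
    have hL30 : Nat.card L = 30 := by omega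
    have : Nontrivial L := Finite.one_lt_card_iff_nontrivial.1 (by omega)
    obtain ⟨z, -, hz⟩ := exists_stabilizer_of_ncard_fixedBy_eq_two (G := L) (X := X)
      fun g hg => hfix g (fun h => hg (Subtype.ext h))
    have hzle : Nat.card (stabilizer L z) ≤ Nat.card (stabilizer G z) :=
      Nat.card_le_card_of_injective (fun g => (⟨g.1, g.2⟩ : stabilizer G z)) fun g k h =>
        Subtype.ext (Subtype.ext (congrArg (fun g : stabilizer G z => (g : G)) h))
    have := hmax z
    omega

end TwoFixedPoints

section SpecialLinear

open Matrix

local notation "SL₂(" R ")" => Matrix.SpecialLinearGroup (Fin 2) R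

/-- The matrix `!![a, b; c, d]` of determinant one. -/
def SL2mk {R : Type*} [CommRing R] (a b c d : R) (h : a * d - b * c = 1) : SL₂(R) :=
  ⟨!![a, b; c, d], by rwa [det_fin_two_of]⟩

section

variable {R : Type*} [CommRing R] {a b c d : R} (h : a * d - b * c = 1)

@[simp] lemma SL2mk_zero_zero : SL2mk a b c d h 0 0 = a := rfl

@[simp] lemma SL2mk_zero_one : SL2mk a b c d h 0 1 = b := rfl

@[simp] lemma SL2mk_one_zero : SL2mk a b c d h 1 0 = c := rfl

@[simp] lemma SL2mk_one_one : SL2mk a b c d h 1 1 = d := rfl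

lemma SL2_mul_apply (A B : SL₂(R)) (i j : Fin 2) :
    (A * B) i j = A i 0 * B 0 j + A i 1 * B 1 j := by
  rw [Matrix.SpecialLinearGroup.coe_mul, mul_apply, Fin.sum_univ_two]

lemma SL2_ext {A B : SL₂(R)} (h₀₀ : A 0 0 = B 0 0) (h₀₁ : A 0 1 = B 0 1) (h₁₀ : A 1 0 = B 1 0)
    (h₁₁ : A 1 1 = B 1 1) : A = B := by
  ext i j
  fin_cases i <;> fin_cases j <;> assumption

lemma SL2_det (A : SL₂(R)) : A 0 0 * A 1 1 - A 0 1 * A 1 0 = 1 := by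
  rw [← det_fin_two, A.det_coe]

end

lemma SL2_mem_center_iff {R : Type*} [CommRing R] {A : SL₂(R)} :
    A ∈ Subgroup.center SL₂(R) ↔ A 0 1 = 0 ∧ A 1 0 = 0 ∧ A 0 0 = A 1 1 := by
  constructor
  · intro h
    obtain ⟨r, -, hr⟩ := Matrix.SpecialLinearGroup.mem_center_iff.1 h
    have hr' : ∀ i j, A i j = scalar (Fin 2) r i j := fun i j => by rw [hr]
    simp [hr']
  · rintro ⟨h₁, h₂, h₃⟩
    refine Matrix.SpecialLinearGroup.mem_center_iff.2 ⟨A 0 0, ?_, ?_⟩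
    · have := A.det_coe
      rw [det_fin_two, h₁, ← h₃] at this
      simpa [sq] using this
    · ext i j
      fin_cases i <;> fin_cases j <;> simp [h₁, h₂, h₃]

variable {p : ℕ} [Fact p.Prime]

/-- The `p`-th power of `A ∈ SL₂(𝔽_p)` is central precisely when `A` has a double eigenvalue. -/
lemma SL2_pow_mem_center_iff {A : SL₂(ZMod p)} :
    A ^ p ∈ Subgroup.center SL₂(ZMod p) ↔ ∃ ε : ZMod p, ε ^ 2 = 1 ∧ A 0 0 + A 1 1 = 2 * ε := by
  have hsub : ∀ r : ZMod p, ((A : Matrix (Fin 2) (Fin 2) (ZMod p)) - scalar (Fin 2) r) ^ p =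
      (A ^ p : SL₂(ZMod p)) - scalar (Fin 2) r := fun r => by
    rw [sub_pow_char_of_commute p (scalar_commute r (Commute.all r) _).symm, ← map_pow,
      ZMod.pow_card, Matrix.SpecialLinearGroup.coe_pow]
  constructor
  · intro h
    obtain ⟨r, hr, hA⟩ := Matrix.SpecialLinearGroup.mem_center_iff.1 h
    refine ⟨r, by simpa using hr, ?_⟩
    have hnil : IsNilpotent ((A : Matrix (Fin 2) (Fin 2) (ZMod p)) - scalar (Fin 2) r) :=
      ⟨p, by rw [hsub, hA, sub_self]⟩
    have := (isNilpotent_trace_of_isNilpotent hnil).eq_zero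
    simp [trace_fin_two] at this
    linear_combination this
  · rintro ⟨ε, hε, htr⟩
    refine Matrix.SpecialLinearGroup.mem_center_iff.2 ⟨ε, by simpa using hε, ?_⟩
    have hdet := SL2_det A
    have hsq : ((A : Matrix (Fin 2) (Fin 2) (ZMod p)) - scalar (Fin 2) ε) ^ 2 = 0 := by
      ext i j
      fin_cases i <;> fin_cases j <;> simp [sq, mul_apply, Fin.sum_univ_two]
      · linear_combination A 0 0 * htr - hdet + hε
      · linear_combination A 0 1 * htr
      · linear_combination A 1 0 * htr
      · linear_combination A 1 1 * htr - hdet + hε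
    have := hsub ε
    rw [pow_eq_zero_of_le (Fact.out : p.Prime).two_le hsq] at this
    exact (sub_eq_zero.1 this.symm).symm

/-- The matrix `!![1, x; 0, 1]`. -/
def upperUnipotent {R : Type*} [CommRing R] (x : R) : SL₂(R) := SL2mk 1 x 0 1 (by simp)

/-- The matrix `!![1, 0; x, 1]`. -/
def lowerUnipotent {R : Type*} [CommRing R] (x : R) : SL₂(R) := SL2mk 1 0 x 1 (by simp)

lemma upperUnipotent_pow {R : Type*} [CommRing R] (x : R) (n : ℕ) :
    upperUnipotent x ^ n = upperUnipotent (n * x) := by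
  induction n with
  | zero => apply SL2_ext <;> simp [upperUnipotent]
  | succ n ih =>
    rw [pow_succ, ih]
    apply SL2_ext <;> simp [upperUnipotent, SL2_mul_apply]
    ring

lemma upperUnipotent_mem {K : Subgroup SL₂(ZMod p)} {s : ZMod p} (hs : s ≠ 0)
    (hK : upperUnipotent s ∈ K) (x : ZMod p) : upperUnipotent x ∈ K := by
  have : upperUnipotent x = upperUnipotent s ^ (x / s).val := by
    rw [upperUnipotent_pow, ZMod.natCast_val, ZMod.cast_id, div_mul_cancel₀ _ hs]
  rw [this]
  exact K.pow_mem hK _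

/-- A subgroup of `SL₂(𝔽_p)` containing a nontrivial upper unipotent matrix and a matrix that is
not upper triangular is everything. -/
lemma eq_top_of_upperUnipotent_mem {K : Subgroup SL₂(ZMod p)} {s : ZMod p} (hs : s ≠ 0)
    (hK : upperUnipotent s ∈ K) {h : SL₂(ZMod p)} (hh : h ∈ K) (hc : h 1 0 ≠ 0) : K = ⊤ := by
  have hU := upperUnipotent_mem hs hK
  have hLo : ∀ x, lowerUnipotent x ∈ K := by
    intro x
    have hw : upperUnipotent (-(h 0 0) / h 1 0) * h * upperUnipotent (-(h 1 1) / h 1 0) ∈ K :=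
      K.mul_mem (K.mul_mem (hU _) hh) (hU _)
    have hdet := SL2_det h
    have : upperUnipotent (-(h 0 0) / h 1 0) * h * upperUnipotent (-(h 1 1) / h 1 0) =
        SL2mk 0 (-(h 1 0)⁻¹) (h 1 0) 0 (by simp [hc]) := by
      apply SL2_ext <;>
        simp [upperUnipotent, SL2_mul_apply] <;> field_simp
      · ring
      · linear_combination -hdet
      · ring
    rw [this] at hw
    have h2 := K.mul_mem (K.mul_mem hw (hU (-x / h 1 0 ^ 2))) (K.inv_mem hw)
    convert h2
    rw [eq_mul_inv_iff_mul_eq]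
    apply SL2_ext <;> simp [upperUnipotent, lowerUnipotent, SL2_mul_apply]
    field_simp
  have key : ∀ g : SL₂(ZMod p), g 1 0 ≠ 0 → g ∈ K := by
    intro g hg
    have hdet := SL2_det g
    have : g = upperUnipotent ((g 0 0 - 1) / g 1 0) * lowerUnipotent (g 1 0) *
        upperUnipotent ((g 1 1 - 1) / g 1 0) := by
      apply SL2_ext <;>
        simp [upperUnipotent, lowerUnipotent, SL2_mul_apply] <;> field_simp
      · ring
      · linear_combination -hdet
      · ring
    rw [this]
    exact K.mul_mem (K.mul_mem (hU _) (hLo _)) (hU _)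
  refine (Subgroup.eq_top_iff' K).2 fun g => ?_
  by_cases hg : g 1 0 = 0
  · rw [← K.mul_mem_cancel_left (hLo 1)]
    apply key
    have hdet := SL2_det g
    rw [hg] at hdet
    simp only [lowerUnipotent, SL2_mul_apply, SL2mk_one_zero, SL2mk_one_one, hg]
    intro h0
    have : g 0 0 = 0 := by linear_combination h0
    simp [this] at hdet
  · exact key g hg

/-- A group of upper triangular matrices over `𝔽_p` with a nontrivial unipotent element is
generated by two elements. -/
lemma exists_closure_pair_of_upperTriangular {K : Subgroup SL₂(ZMod p)} {s : ZMod p} (hs : s ≠ 0)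
    (hK : upperUnipotent s ∈ K) (hc : ∀ h ∈ K, h 1 0 = 0) :
    ∃ b, Subgroup.closure {upperUnipotent s, b} = K := by
  let χ : K →* (ZMod p)ˣ := MonoidHom.toHomUnits
    { toFun := fun h => h.1 1 1
      map_one' := by simp
      map_mul' := fun g h => by simp [SL2_mul_apply, hc g.1 g.2] }
  obtain ⟨⟨_, b, rfl⟩, hb⟩ := IsCyclic.exists_generator (α := χ.range)
  refine ⟨b, le_antisymm ?_ fun h hh => ?_⟩
  · rw [Subgroup.closure_le]
    rintro _ (rfl | rfl)
    · exact hK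
    · exact b.2
  · obtain ⟨k, hk⟩ := hb ⟨χ ⟨h, hh⟩, _, rfl⟩
    have hk' : χ b ^ k = χ ⟨h, hh⟩ := congrArg Subtype.val hk
    have hbk : (b : SL₂(ZMod p)) ∈ Subgroup.closure {upperUnipotent s, (b : SL₂(ZMod p))} :=
      Subgroup.subset_closure (by simp)
    rw [← Subgroup.mul_mem_cancel_right _ (Subgroup.inv_mem _ (Subgroup.zpow_mem _ hbk k))]
    have hgK := K.mul_mem hh (K.inv_mem (K.zpow_mem b.2 k))
    set g := h * ((b : SL₂(ZMod p)) ^ k)⁻¹ with hg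
    have hχ : χ ⟨g, hgK⟩ = 1 := by
      have : (⟨g, hgK⟩ : K) = ⟨h, hh⟩ * (b ^ k)⁻¹ := Subtype.ext (by simp [hg])
      rw [this, map_mul, map_inv, map_zpow, hk', mul_inv_cancel]
    have h11 : g 1 1 = 1 := congrArg Units.val hχ
    have h10 := hc g hgK
    have hdet := SL2_det g
    rw [h11, h10] at hdet
    have : g = upperUnipotent (g 0 1) := by
      apply SL2_ext <;> simp [upperUnipotent, h10, h11]
      linear_combination hdet
    rw [this]
    exact upperUnipotent_mem hs (Subgroup.subset_closure (by simp)) _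

/-- A subgroup of `SL₂(𝔽_p)` which contains the center, and a noncentral element with central
`p`-th power, contains a conjugate of a nontrivial upper unipotent matrix. -/
lemma exists_conj_upperUnipotent_mem {K : Subgroup SL₂(ZMod p)}
    (hZ : Subgroup.center SL₂(ZMod p) ≤ K) {A : SL₂(ZMod p)} (hA : A ∈ K)
    (hAZ : A ∉ Subgroup.center SL₂(ZMod p)) (hAp : A ^ p ∈ Subgroup.center SL₂(ZMod p)) :
    ∃ (P : SL₂(ZMod p)) (s : ZMod p), s ≠ 0 ∧ P * upperUnipotent s * P⁻¹ ∈ K := by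
  obtain ⟨ε, hε, htr⟩ := SL2_pow_mem_center_iff.1 hAp
  have hdet := SL2_det A
  have hε0 : ε ≠ 0 := by rintro rfl; simp at hε
  let Z : SL₂(ZMod p) := SL2mk ε 0 0 ε (by linear_combination hε)
  have hZA : Z * A ∈ K := K.mul_mem (hZ (SL2_mem_center_iff.2 (by simp [Z]))) hA
  by_cases hc : A 1 0 = 0
  · have ha : A 0 0 = ε := by
      rw [hc] at hdet
      have : (A 0 0 - ε) ^ 2 = 0 := by linear_combination A 0 0 * htr - hdet + hε
      exact sub_eq_zero.1 (pow_eq_zero_iff two_ne_zero |>.1 this)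
    have hd : A 1 1 = ε := by linear_combination htr - ha
    refine ⟨1, ε * A 0 1, mul_ne_zero hε0 fun hb => ?_, ?_⟩
    · exact hAZ (SL2_mem_center_iff.2 ⟨hb, hc, ha.trans hd.symm⟩)
    · convert hZA using 1
      apply SL2_ext <;>
        simp [Z, upperUnipotent, SL2_mul_apply, hc, ha, hd]
      · linear_combination -hε
      · linear_combination -hε
  · have hk : ε * A 1 0 ≠ 0 := mul_ne_zero hε0 hc
    refine ⟨SL2mk (ε * A 0 0 - 1) (-(ε * A 1 0)⁻¹) (ε * A 1 0) 0 ?_, -(ε * A 1 0)⁻¹,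
      neg_ne_zero.2 (inv_ne_zero hk), ?_⟩
    · field_simp
      ring
    · convert hZA using 1
      rw [mul_inv_eq_iff_eq_mul]
      apply SL2_ext <;>
        simp [Z, upperUnipotent, SL2_mul_apply] <;> try field_simp
      · linear_combination ε ^ 2 * hdet + hε - ε ^ 2 * A 0 0 * htr - 2 * ε * A 0 0 * hε
      · ring
      · linear_combination -ε * htr - 2 * hε

/-- A subgroup of `SL₂(𝔽_p)` which contains the center, and a noncentral element with central
`p`-th power, is generated by two elements. -/
theorem exists_closure_pair_of_pow_mem_center {K : Subgroup SL₂(ZMod p)}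
    (hZ : Subgroup.center SL₂(ZMod p) ≤ K) {A : SL₂(ZMod p)} (hA : A ∈ K)
    (hAZ : A ∉ Subgroup.center SL₂(ZMod p)) (hAp : A ^ p ∈ Subgroup.center SL₂(ZMod p)) :
    ∃ a b : SL₂(ZMod p), Subgroup.closure {a, b} = K := by
  obtain ⟨P, s, hs, hP⟩ := exists_conj_upperUnipotent_mem hZ hA hAZ hAp
  have hK : upperUnipotent s ∈ K.comap (MulAut.conj P).toMonoidHom := hP
  obtain ⟨b, hb⟩ : ∃ b, Subgroup.closure {upperUnipotent s, b} =
      K.comap (MulAut.conj P).toMonoidHom := by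
    by_cases hc : ∀ h ∈ K.comap (MulAut.conj P).toMonoidHom, h 1 0 = 0
    · exact exists_closure_pair_of_upperTriangular hs hK hc
    · push Not at hc
      obtain ⟨h, hh, hc⟩ := hc
      refine ⟨h, ?_⟩
      rw [eq_top_of_upperUnipotent_mem hs hK hh hc]
      exact eq_top_of_upperUnipotent_mem hs (Subgroup.subset_closure (by simp))
        (Subgroup.subset_closure (by simp)) hc
  refine ⟨MulAut.conj P (upperUnipotent s), MulAut.conj P b, ?_⟩
  rw [← Subgroup.map_comap_eq_self_of_surjective (f := (MulAut.conj P).toMonoidHom)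
    (MulAut.conj P).surjective K, ← hb,
    MonoidHom.map_closure, Set.image_pair]
  rfl


section Moebius

open Classical MulAction OnePoint

variable (p) (K : Type*) [Field K] [Algebra (ZMod p) K]

/-- The action of `SL₂(𝔽_p)` by Möbius transformations on the projective line over an
extension `K` of `𝔽_p`. -/
noncomputable def moebius : SL₂(ZMod p) →* Equiv.Perm (OnePoint K) :=
  (toPermHom (GL (Fin 2) K) (OnePoint K)).comp
    (Matrix.SpecialLinearGroup.toGL.comp (Matrix.SpecialLinearGroup.map (algebraMap (ZMod p) K)))

variable {p K}

local notation "ι" => algebraMap (ZMod p) K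

lemma moebius_infty_eq_iff (A : SL₂(ZMod p)) :
    moebius p K A ∞ = ∞ ↔ A 1 0 = 0 := by
  refine (smul_infty_eq_self_iff (K := K)).trans ?_
  exact map_eq_zero ι

lemma moebius_coe_eq_iff (A : SL₂(ZMod p)) (t : K) :
    moebius p K A t = t ↔ ι (A 1 0) * t ^ 2 + ι (A 1 1 - A 0 0) * t - ι (A 0 1) = 0 := by
  refine (GeneralLinearGroup.fixpointPolynomial_aeval_eq_zero_iff (K := K)).symm.trans ?_
  simp [GeneralLinearGroup.fixpointPolynomial]

lemma center_le_ker_moebius : Subgroup.center SL₂(ZMod p) ≤ (moebius p K).ker := by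
  intro A hA
  obtain ⟨h₁, h₂, h₃⟩ := SL2_mem_center_iff.1 hA
  refine MonoidHom.mem_ker.2 (Equiv.ext fun x => ?_)
  induction x using OnePoint.rec with
  | infty => exact (moebius_infty_eq_iff A).2 h₂
  | coe t => exact (moebius_coe_eq_iff A t).2 (by simp [h₁, h₂, h₃])

/-- An element of `SL₂(𝔽_p)` without double eigenvalue has exactly two fixed points on the
projective line over a field in which all elements of `𝔽_p` are squares. -/
lemma ncard_fixed_moebius (hp : p ≠ 2) (hsq : ∀ a : ZMod p, IsSquare (ι a)) {A : SL₂(ZMod p)}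
    (hA : A ^ p ∉ Subgroup.center SL₂(ZMod p)) :
    {x : OnePoint K | moebius p K A x = x}.ncard = 2 := by
  have h2 : (2 : ZMod p) ≠ 0 :=
    Ring.two_ne_zero (by rwa [ZMod.ringChar_zmod_n])
  have h2K : (2 : K) ≠ 0 := by
    have := (map_ne_zero ι).2 h2
    rwa [map_ofNat] at this
  have hdet := SL2_det A
  have hdisc : (A 0 0 + A 1 1) ^ 2 ≠ 4 := fun h => hA <| SL2_pow_mem_center_iff.2
    ⟨(A 0 0 + A 1 1) / 2, by field_simp; linear_combination h, by field_simp⟩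
  rw [Set.ncard_eq_two]
  by_cases hc : A 1 0 = 0
  · have had : A 1 1 - A 0 0 ≠ 0 := fun h => hdisc <| by
      rw [hc] at hdet
      linear_combination (A 1 1 - A 0 0) * h + 4 * hdet
    have had' : ι (A 1 1 - A 0 0) ≠ 0 := (map_ne_zero ι).2 had
    refine ⟨∞, ((ι (A 0 1) / ι (A 1 1 - A 0 0) : K) : OnePoint K), infty_ne_coe _, ?_⟩
    ext x
    induction x using OnePoint.rec with
    | infty => simp [moebius_infty_eq_iff, hc]
    | coe t =>
      simp only [Set.mem_ofPred_eq, moebius_coe_eq_iff, hc, map_zero, Set.mem_insert_iff,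
        coe_ne_infty, Set.mem_singleton_iff, coe_eq_coe, false_or, eq_div_iff had', zero_mul,
        zero_add, sub_eq_zero, mul_comm t]
  · obtain ⟨r, hr⟩ := hsq ((A 0 0 + A 1 1) ^ 2 - 4)
    have hr0 : r ≠ 0 := by
      rintro rfl
      rw [mul_zero, map_eq_zero, sub_eq_zero] at hr
      exact hdisc hr
    have hc' : ι (A 1 0) ≠ 0 := (map_ne_zero ι).2 hc
    have hdet' := congrArg ι hdet
    simp only [map_sub, map_mul, map_pow, map_add, map_one, map_ofNat] at hr hdet'
    have h2c : 2 * ι (A 1 0) ≠ 0 := mul_ne_zero h2K hc'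
    refine ⟨(((ι (A 0 0) - ι (A 1 1) + r) / (2 * ι (A 1 0)) : K) : OnePoint K),
      (((ι (A 0 0) - ι (A 1 1) - r) / (2 * ι (A 1 0)) : K) : OnePoint K), ?_, ?_⟩
    · rw [Ne, coe_eq_coe, div_left_inj' h2c]
      intro h
      exact mul_ne_zero h2K hr0 (by linear_combination h)
    · ext x
      induction x using OnePoint.rec with
      | infty => simp [moebius_infty_eq_iff, hc]
      | coe t =>
        simp only [Set.mem_ofPred_eq, moebius_coe_eq_iff, Set.mem_insert_iff,
          Set.mem_singleton_iff, coe_eq_coe, eq_div_iff h2c, map_sub]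
        rw [← sub_eq_zero (b := ι (A 0 0) - ι (A 1 1) + r),
          ← sub_eq_zero (b := ι (A 0 0) - ι (A 1 1) - r), ← mul_eq_zero,
          ← mul_right_inj' (mul_ne_zero (mul_ne_zero h2K h2K) hc'), mul_zero]
        constructor <;> intro h
        · linear_combination h + hr - 4 * hdet'
        · linear_combination h - hr + 4 * hdet'

/-- A group of Möbius transformations with a common fixed point which has no nontrivial unipotent
elements is cyclic. -/
lemma isCyclic_of_forall_moebius_eq {S : Subgroup SL₂(ZMod p)} {x : OnePoint K}
    (hS : ∀ A ∈ S, A ^ p ∈ Subgroup.center SL₂(ZMod p) → A ∈ Subgroup.center SL₂(ZMod p))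
    (hx : ∀ A ∈ S, moebius p K A x = x) : IsCyclic S := by
  have htr : ∀ A ∈ S, ι (A 0 0 + A 1 1) = 2 → A ∈ Subgroup.center SL₂(ZMod p) := by
    refine fun A hA h => hS A hA (SL2_pow_mem_center_iff.2 ⟨1, by simp, ?_⟩)
    rw [← map_ofNat ι 2] at h
    simpa using (algebraMap (ZMod p) K).injective h
  induction x using OnePoint.rec with
  | infty =>
    have hc : ∀ A ∈ S, A 1 0 = 0 := fun A hA => (moebius_infty_eq_iff A).1 (hx A hA)
    let χ : S →* ZMod p :=
      { toFun := fun A => A.1 0 0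
        map_one' := by simp
        map_mul' := fun A B => by simp [SL2_mul_apply, hc B.1 B.2] }
    refine isCyclic_of_injective_ringHom χ ((injective_iff_map_eq_one χ).2 fun A hA => ?_)
    replace hA : A.1 0 0 = 1 := hA
    have hdet := SL2_det A.1
    rw [hA, hc A.1 A.2] at hdet
    have h11 : A.1 1 1 = 1 := by linear_combination hdet
    have hcen := SL2_mem_center_iff.1 (htr A.1 A.2 (by rw [hA, h11, map_add, map_one]; norm_num))
    exact Subtype.ext (SL2_ext (by simp [hA]) (by simp [hcen.1]) (by simp [hcen.2.1])
      (by simp [h11]))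
  | coe t =>
    have hc : ∀ A ∈ S, ι (A 0 0) * t + ι (A 0 1) = t * (ι (A 1 0) * t + ι (A 1 1)) :=
      fun A hA => by
        have := (moebius_coe_eq_iff A t).1 (hx A hA)
        rw [map_sub] at this
        linear_combination -this
    let χ : S →* K :=
      { toFun := fun A => ι (A.1 1 0) * t + ι (A.1 1 1)
        map_one' := by simp
        map_mul' := fun A B => by
          simp only [Subgroup.coe_mul, SL2_mul_apply, map_add, map_mul]
          linear_combination ι (A.1 1 0) * hc B.1 B.2 }
    refine isCyclic_of_injective_ringHom χ ((injective_iff_map_eq_one χ).2 fun A hA => ?_)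
    replace hA : ι (A.1 1 0) * t + ι (A.1 1 1) = 1 := hA
    have hdet := congrArg ι (SL2_det A.1)
    simp only [map_sub, map_mul, map_one] at hdet
    have hAt := hc A.1 A.2
    rw [hA, mul_one] at hAt
    have hcen := SL2_mem_center_iff.1 (htr A.1 A.2 (by
      rw [map_add]
      linear_combination hdet + ι (A.1 1 0) * hAt + (1 - ι (A.1 0 0)) * hA))
    have h11 : A.1 1 1 = 1 := by
      rw [hcen.2.1, map_zero, zero_mul, zero_add] at hA
      exact (algebraMap (ZMod p) K).injective (by rw [hA, map_one])
    exact Subtype.ext (SL2_ext (by simp [hcen.2.2, h11]) (by simp [hcen.1]) (by simp [hcen.2.1])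
      (by simp [h11]))

local notation "PSL₂" => SL₂(ZMod p) ⧸ Subgroup.center SL₂(ZMod p)

/-- A subgroup of `PSL₂(𝔽_p)` of order prime to `p`, where `p` is odd, is generated by two
elements. -/
theorem exists_closure_pair_of_not_dvd_card (hp : p ≠ 2) [Finite K]
    (hsq : ∀ a : ZMod p, IsSquare (ι a)) {H : Subgroup PSL₂} (hH : ¬ p ∣ Nat.card H) :
    ∃ a b : PSL₂, Subgroup.closure {a, b} = H := by
  let φ : PSL₂ →* Equiv.Perm (OnePoint K) := QuotientGroup.lift _ (moebius p K)
    center_le_ker_moebius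
  have hcen : ∀ A : SL₂(ZMod p), (A : PSL₂) ∈ H → A ^ p ∈ Subgroup.center SL₂(ZMod p) →
      A ∈ Subgroup.center SL₂(ZMod p) := by
    intro A hA hAp
    by_contra h
    have h1 : (⟨A, hA⟩ : H) ^ p = 1 :=
      Subtype.ext ((QuotientGroup.eq_one_iff (A ^ p)).2 hAp)
    have h2 : (⟨A, hA⟩ : H) ≠ 1 := fun h' =>
      h ((QuotientGroup.eq_one_iff A).1 (congrArg Subtype.val h'))
    have h3 := orderOf_dvd_natCard (⟨A, hA⟩ : H)
    rw [orderOf_eq_prime h1 h2] at h3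
    exact hH h3
  let _ : MulAction H (OnePoint K) := MulAction.compHom _ (φ.comp H.subtype)
  have : Finite (OnePoint K) := inferInstanceAs (Finite (Option K))
  obtain ⟨a, b, hab⟩ := exists_closure_pair_eq_top_of_ncard_fixedBy_eq_two (G := H)
    (X := OnePoint K) (by
      rintro ⟨h, hh⟩ h1
      obtain ⟨A, rfl⟩ := QuotientGroup.mk_surjective h
      refine ncard_fixed_moebius hp hsq fun hAp => h1 ?_
      exact Subtype.ext ((QuotientGroup.eq_one_iff A).2 (hcen A hh hAp))) (by
      intro x
      let S : Subgroup SL₂(ZMod p) := H.comap (QuotientGroup.mk' _) ⊓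
        (stabilizer (Equiv.Perm (OnePoint K)) x).comap (moebius p K)
      have : IsCyclic S := isCyclic_of_forall_moebius_eq (x := x)
        (fun A hA => hcen A hA.1) fun A hA => hA.2
      let f : S →* stabilizer H x :=
        { toFun := fun A => ⟨⟨(A.1 : PSL₂), A.2.1⟩, A.2.2⟩
          map_one' := rfl
          map_mul' := fun _ _ => rfl }
      refine isCyclic_of_surjective f ?_
      rintro ⟨⟨h, hh⟩, hx⟩
      obtain ⟨A, rfl⟩ := QuotientGroup.mk_surjective h
      exact ⟨⟨A, hh, hx⟩, rfl⟩)
  refine ⟨a, b, ?_⟩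
  have := congrArg (Subgroup.map H.subtype) hab
  rwa [MonoidHom.map_closure, Set.image_pair, ← MonoidHom.range_eq_map, H.range_subtype] at this

end Moebius

/-- Every element of `𝔽_p` is a square in the field with `p ^ 2` elements. -/
lemma isSquare_algebraMap_galoisField (a : ZMod p) :
    IsSquare (algebraMap (ZMod p) (GaloisField p 2) a) := by
  rcases eq_or_ne a 0 with rfl | ha
  · simp
  have := Fintype.ofFinite (GaloisField p 2)
  by_cases hp : p = 2
  · have : CharP (GaloisField p 2) 2 := hp ▸ inferInstance
    exact FiniteField.isSquare_of_char_two (ringChar.eq_iff.2 this) _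
  have hodd := (Fact.out : p.Prime).odd_of_ne_two hp
  rw [FiniteField.isSquare_iff (by rwa [ringChar.eq (GaloisField p 2) p]) ((map_ne_zero _).2 ha),
    ← Nat.card_eq_fintype_card, GaloisField.card p 2 two_ne_zero]
  obtain ⟨k, hk⟩ := hodd
  have : p ^ 2 / 2 = (p - 1) * (k + 1) := by
    subst hk
    have : (2 * k + 1) ^ 2 = 2 * (2 * k * (k + 1)) + 1 := by ring
    rw [this, Nat.add_sub_cancel]
    omega
  rw [this, pow_mul, ← map_pow, ZMod.pow_card_sub_one_eq_one ha, map_one, one_pow]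

/-- A group of order dividing six and not divisible by two is cyclic. -/
lemma isCyclic_of_card_dvd_six {G : Type*} [Group G] (h6 : Nat.card G ∣ 6)
    (h2 : ¬ 2 ∣ Nat.card G) : IsCyclic G := by
  have hle := Nat.le_of_dvd (by norm_num) h6
  interval_cases h : Nat.card G
  · norm_num at h6
  · have := (Nat.card_eq_one_iff_unique.1 h).1
    exact isCyclic_of_subsingleton
  · norm_num at h2
  · have : Fact (Nat.Prime 3) := ⟨Nat.prime_three⟩
    exact isCyclic_of_prime_card h
  all_goals omega

lemma card_SL2_zmod_two : Nat.card SL₂(ZMod 2) = 6 := by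
  rw [Nat.card_eq_fintype_card]
  decide

end SpecialLinear

/-- For every prime `p`, every subgroup of `PSL₂(𝔽_p)` is generated by at most
two elements; that is, `PSL₂(𝔽_p)` has rank at most `2`. -/
theorem PSL2_rank_le_two (p : ℕ) (hp : p.Prime)
    (H : Subgroup (Matrix.SpecialLinearGroup (Fin 2) (ZMod p) ⧸
      Subgroup.center (Matrix.SpecialLinearGroup (Fin 2) (ZMod p)))) :
    ∃ S : Set (Matrix.SpecialLinearGroup (Fin 2) (ZMod p) ⧸
      Subgroup.center (Matrix.SpecialLinearGroup (Fin 2) (ZMod p))),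
      S.ncard ≤ 2 ∧ Subgroup.closure S = H := by
  have : Fact p.Prime := ⟨hp⟩
  suffices h : ∃ a b, Subgroup.closure {a, b} = H by
    obtain ⟨a, b, h⟩ := h
    exact ⟨{a, b}, (Set.ncard_insert_le a {b}).trans (by rw [Set.ncard_singleton]), h⟩
  by_cases hdvd : p ∣ Nat.card H
  · obtain ⟨⟨h, hh⟩, hord⟩ := exists_prime_orderOf_dvd_card' p hdvd
    obtain ⟨A, rfl⟩ := QuotientGroup.mk_surjective h
    have hAp : A ^ p ∈ Subgroup.center (Matrix.SpecialLinearGroup (Fin 2) (ZMod p)) :=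
      (QuotientGroup.eq_one_iff (A ^ p)).1 (congrArg Subtype.val (hord ▸ pow_orderOf_eq_one _))
    have hA : A ∉ Subgroup.center (Matrix.SpecialLinearGroup (Fin 2) (ZMod p)) := fun hA => by
      have h1 := Subtype.ext ((QuotientGroup.eq_one_iff A).2 hA) (a1 := ⟨_, hh⟩) (a2 := (1 : H))
      rw [h1, orderOf_one] at hord
      exact hp.one_lt.ne hord
    obtain ⟨a, b, hab⟩ := exists_closure_pair_of_pow_mem_center
      (K := H.comap (QuotientGroup.mk' _)) (A := A)
      ((QuotientGroup.ker_mk' _).symm.le.trans (MonoidHom.ker_le_comap _ _)) hh hA hAp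
    refine ⟨a, b, ?_⟩
    have := congrArg (Subgroup.map (QuotientGroup.mk'
      (Subgroup.center (Matrix.SpecialLinearGroup (Fin 2) (ZMod p))))) hab
    rwa [MonoidHom.map_closure, Set.image_pair, Subgroup.map_comap_eq_self_of_surjective
      (QuotientGroup.mk'_surjective _)] at this
  · by_cases hp2 : p = 2
    · subst hp2
      have hdvd6 : Nat.card H ∣ 6 := card_SL2_zmod_two ▸
        H.card_subgroup_dvd_card.trans (Subgroup.card_quotient_dvd_card _)
      obtain ⟨a, ha⟩ := (Subgroup.isCyclic_iff_exists_zpowers_eq_top H).1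
        (isCyclic_of_card_dvd_six hdvd6 hdvd)
      exact ⟨a, a, by rw [Set.pair_eq_singleton, ← Subgroup.zpowers_eq_closure, ha]⟩
    · exact exists_closure_pair_of_not_dvd_card (K := GaloisField p 2) hp2
        isSquare_algebraMap_galoisField hdvd
end

section
/- Let S be a finite group and n a positive integer such that every proper subgroup of S has index greater than n. Then for every positive integer a, every proper subgroup of the direct power S^a has index greater than n. Equivalently, the minimal index of a proper subgroup of S^a equals the minimal index of a proper subgroup of S. -/
/-- A proper subgroup of a finite product pulls back to a proper subgroup of some factor,
of no larger index. -/
theorem Subgroup.exists_comap_mulSingle_ne_top_index_le {ι : Type*} [Finite ι] [DecidableEq ι]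
    {G : ι → Type*} [∀ i, Group (G i)] [∀ i, Finite (G i)]
    (K : Subgroup (∀ i, G i)) (hK : K ≠ ⊤) :
    ∃ i, K.comap (MonoidHom.mulSingle G i) ≠ ⊤ ∧
      (K.comap (MonoidHom.mulSingle G i)).index ≤ K.index := by
  by_contra! hc
  refine hK ((Subgroup.eq_top_iff' K).2 fun x => ?_)
  refine Subgroup.pi_mem_of_mulSingle_mem x fun i => ?_
  by_cases hi : K.comap (MonoidHom.mulSingle G i) = ⊤
  · have hx : x i ∈ K.comap (MonoidHom.mulSingle G i) := hi ▸ Subgroup.mem_top _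
    exact hx
  · refine absurd (hc i hi) (not_lt.2 ?_)
    rw [Subgroup.index_comap, ← K.relIndex_top_right]
    refine Subgroup.relIndex_le_of_le_right le_top ?_
    rw [K.relIndex_top_right]
    exact Subgroup.index_ne_zero_of_finite

/-- Every index of a proper subgroup of `G` is the index of a proper subgroup of
any group mapping onto `G`. -/
theorem Subgroup.comap_ne_top_and_index_eq_of_surjective {G G' : Type*} [Group G] [Group G']
    {f : G' →* G} (hf : Function.Surjective f) (H : Subgroup G) (hH : H ≠ ⊤) :
    H.comap f ≠ ⊤ ∧ (H.comap f).index = H.index := by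
  have hi := H.index_comap_of_surjective hf
  exact ⟨fun ht => hH (Subgroup.index_eq_one.1 (hi ▸ Subgroup.index_eq_one.2 ht)), hi⟩


/-- If every proper subgroup of the finite group `S` has index greater than `n`,
then for every `a ≥ 1` every proper subgroup of the direct power `S^a` has index
greater than `n`; equivalently, the minimal index of a proper subgroup of `S^a`
equals the minimal index of a proper subgroup of `S`. -/
theorem minimal_index_direct_power {S : Type*} [Group S] [Finite S]
    (n : ℕ) (hn : 0 < n) (h : ∀ H : Subgroup S, H ≠ ⊤ → n < H.index)
    (a : ℕ) (ha : 0 < a) :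
    (∀ K : Subgroup (Fin a → S), K ≠ ⊤ → n < K.index) ∧
    sInf {m : ℕ | ∃ K : Subgroup (Fin a → S), K ≠ ⊤ ∧ K.index = m} =
      sInf {m : ℕ | ∃ H : Subgroup S, H ≠ ⊤ ∧ H.index = m} := by
  refine ⟨fun K hK => ?_, ?_⟩
  · obtain ⟨i, hi, hle⟩ := K.exists_comap_mulSingle_ne_top_index_le hK
    exact (h _ hi).trans_le hle
  have hsurj : Function.Surjective (Pi.evalMonoidHom (fun _ : Fin a => S) ⟨0, ha⟩) :=
    Function.surjective_eval _
  by_cases hS : ∃ H : Subgroup S, H ≠ ⊤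
  · obtain ⟨H₀, hH₀⟩ := hS
    have hc := H₀.comap_ne_top_and_index_eq_of_surjective hsurj hH₀
    apply le_antisymm
    · refine le_csInf ⟨_, H₀, hH₀, rfl⟩ ?_
      rintro _ ⟨H, hH, rfl⟩
      exact Nat.sInf_le ⟨_, H.comap_ne_top_and_index_eq_of_surjective hsurj hH⟩
    · refine le_csInf ⟨_, _, hc⟩ ?_
      rintro _ ⟨K, hK, rfl⟩
      obtain ⟨i, hi, hle⟩ := K.exists_comap_mulSingle_ne_top_index_le hK
      exact le_trans (Nat.sInf_le (by exact ⟨_, hi, rfl⟩)) hle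
  · congr 1
    ext m
    constructor
    · rintro ⟨K, hK, -⟩
      obtain ⟨i, hi, -⟩ := K.exists_comap_mulSingle_ne_top_index_le hK
      exact absurd ⟨_, hi⟩ hS
    · rintro ⟨H, hH, -⟩
      exact absurd ⟨H, hH⟩ hS
end
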